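/- arXiv:1912.12580 — 2 statements merged into one kernel-verified Lean document; each statement's English description precedes it below -/
import Mathlib

section
/- Let H, Y, N be finite-dimensional real inner product spaces, A : H → H, B : N → H, C : H → Y, Q : N → N linear, R : Y → Y self-adjoint positive definite, Σ : H → H self-adjoint, and M : H → H self-adjoint positive semidefinite. For K : Y → H linear, let F(K) := (A − K∘C)∘Σ + Σ∘(A − K∘C)* + B∘Q∘B* + K∘R∘K*, and K₀ := Σ∘C*∘R⁻¹. Then for every K, the operator F(K) − F(K₀) = (K−K₀)∘R∘(K−K₀)* is positive semidefinite, and consequently trace(M ∘ F(K₀)) ≤ trace(M ∘ F(K)); i.e., the Kalman gain K₀ = ΣC*R⁻¹ minimizes K ↦ ⟨M, F(K)⟩. -/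
open scoped RealInnerProductSpace

/-- The right-hand side `F(K)` of the covariance dynamics of the linearized Kalman filter
error: `F(K) = (A − KC)Σ + Σ(A − KC)* + BQB* + KRK*`. -/
noncomputable def covRHS {H Y N : Type*}
    [NormedAddCommGroup H] [InnerProductSpace ℝ H] [FiniteDimensional ℝ H]
    [NormedAddCommGroup Y] [InnerProductSpace ℝ Y] [FiniteDimensional ℝ Y]
    [NormedAddCommGroup N] [InnerProductSpace ℝ N] [FiniteDimensional ℝ N]
    (A : H →ₗ[ℝ] H) (B : N →ₗ[ℝ] H) (C : H →ₗ[ℝ] Y) (Q : N →ₗ[ℝ] N) (R : Y →ₗ[ℝ] Y)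
    (S : H →ₗ[ℝ] H) (K : Y →ₗ[ℝ] H) : H →ₗ[ℝ] H :=
  (A - K ∘ₗ C) ∘ₗ S + S ∘ₗ LinearMap.adjoint (A - K ∘ₗ C)
    + B ∘ₗ Q ∘ₗ LinearMap.adjoint B + K ∘ₗ R ∘ₗ LinearMap.adjoint K

/-- The trace of the product of two positive operators is nonnegative. -/
theorem LinearMap.IsPositive.trace_comp_nonneg {E : Type*} [NormedAddCommGroup E]
    [InnerProductSpace ℝ E] [FiniteDimensional ℝ E] {T P : E →ₗ[ℝ] E}
    (hT : T.IsPositive) (hP : P.IsPositive) : 0 ≤ LinearMap.trace ℝ E (T ∘ₗ P) := by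
  rw [LinearMap.trace_eq_sum_inner _ (hP.isSymmetric.eigenvectorBasis rfl)]
  refine Finset.sum_nonneg fun i _ => ?_
  rw [LinearMap.comp_apply, hP.isSymmetric.apply_eigenvectorBasis, map_smul, inner_smul_right]
  exact mul_nonneg (hP.nonneg_eigenvalues rfl i) (hT.inner_nonneg_right _)

/-- A self-adjoint real operator with nonnegative quadratic form is positive. -/
theorem LinearMap.IsPositive.of_adjoint_eq {E : Type*} [NormedAddCommGroup E]
    [InnerProductSpace ℝ E] [FiniteDimensional ℝ E] {T : E →ₗ[ℝ] E}
    (hT : LinearMap.adjoint T = T) (h : ∀ x, 0 ≤ ⟪x, T x⟫) : T.IsPositive :=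
  ⟨(LinearMap.isSymmetric_iff_isSelfAdjoint T).2 hT, fun x => by
    simpa [real_inner_comm] using h x⟩

/-- Completing the square in the covariance dynamics at a gain `L` with `L R = Σ C*`. -/
theorem covRHS_sub_eq_of_comp_eq {H Y N : Type*}
    [NormedAddCommGroup H] [InnerProductSpace ℝ H] [FiniteDimensional ℝ H]
    [NormedAddCommGroup Y] [InnerProductSpace ℝ Y] [FiniteDimensional ℝ Y]
    [NormedAddCommGroup N] [InnerProductSpace ℝ N] [FiniteDimensional ℝ N]
    (A : H →ₗ[ℝ] H) (B : N →ₗ[ℝ] H) (C : H →ₗ[ℝ] Y) (Q : N →ₗ[ℝ] N) {R : Y →ₗ[ℝ] Y}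
    {S : H →ₗ[ℝ] H} (hR : LinearMap.adjoint R = R) (hS : LinearMap.adjoint S = S)
    {L : Y →ₗ[ℝ] H} (hL : L ∘ₗ R = S ∘ₗ LinearMap.adjoint C) (K : Y →ₗ[ℝ] H) :
    covRHS A B C Q R S K - covRHS A B C Q R S L
      = (K - L) ∘ₗ R ∘ₗ LinearMap.adjoint (K - L) := by
  have hL' : R ∘ₗ LinearMap.adjoint L = C ∘ₗ S := by
    simpa [LinearMap.adjoint_comp, hR, hS] using congrArg LinearMap.adjoint hL
  ext x
  have h₁ : ∀ y, L (R y) = S (LinearMap.adjoint C y) := LinearMap.congr_fun hL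
  have h₂ : ∀ z, R (LinearMap.adjoint L z) = C (S z) := LinearMap.congr_fun hL'
  have h₃ : S (LinearMap.adjoint C (LinearMap.adjoint L x)) = L (C (S x)) := by
    rw [← h₁, h₂]
  simp only [covRHS, map_sub, LinearMap.adjoint_comp, LinearMap.add_apply, LinearMap.sub_apply,
    LinearMap.comp_apply, h₁, h₂, h₃]
  abel

/-- With `R` self-adjoint positive definite (with inverse `Rinv`), `Σ`
self-adjoint, `M` self-adjoint positive semidefinite, and `K₀ := Σ C* R⁻¹`: for every gain `K`,
`F(K) − F(K₀) = (K − K₀) R (K − K₀)*` is positive semidefinite, and consequently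
`trace (M ∘ F(K₀)) ≤ trace (M ∘ F(K))`; i.e. `K₀` minimizes `K ↦ ⟨M, F(K)⟩`. -/
theorem kalman_gain_minimizes
    {H Y N : Type*}
    [NormedAddCommGroup H] [InnerProductSpace ℝ H] [FiniteDimensional ℝ H]
    [NormedAddCommGroup Y] [InnerProductSpace ℝ Y] [FiniteDimensional ℝ Y]
    [NormedAddCommGroup N] [InnerProductSpace ℝ N] [FiniteDimensional ℝ N]
    (A : H →ₗ[ℝ] H) (B : N →ₗ[ℝ] H) (C : H →ₗ[ℝ] Y) (Q : N →ₗ[ℝ] N) (R Rinv : Y →ₗ[ℝ] Y)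
    (S : H →ₗ[ℝ] H) (M : H →ₗ[ℝ] H)
    (hR : LinearMap.adjoint R = R)
    (hRpos : ∀ y : Y, y ≠ 0 → 0 < ⟪y, R y⟫)
    (hRinv₁ : R ∘ₗ Rinv = LinearMap.id) (hRinv₂ : Rinv ∘ₗ R = LinearMap.id)
    (hS : LinearMap.adjoint S = S)
    (hM : LinearMap.adjoint M = M)
    (hMpos : ∀ x : H, 0 ≤ ⟪x, M x⟫)
    (K : Y →ₗ[ℝ] H) :
    (covRHS A B C Q R S K - covRHS A B C Q R S (S ∘ₗ LinearMap.adjoint C ∘ₗ Rinv)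
        = (K - S ∘ₗ LinearMap.adjoint C ∘ₗ Rinv) ∘ₗ R
            ∘ₗ LinearMap.adjoint (K - S ∘ₗ LinearMap.adjoint C ∘ₗ Rinv))
      ∧
    (∀ x : H, 0 ≤ ⟪x, (covRHS A B C Q R S K
        - covRHS A B C Q R S (S ∘ₗ LinearMap.adjoint C ∘ₗ Rinv)) x⟫)
      ∧
    LinearMap.trace ℝ H (M ∘ₗ covRHS A B C Q R S (S ∘ₗ LinearMap.adjoint C ∘ₗ Rinv))
        ≤ LinearMap.trace ℝ H (M ∘ₗ covRHS A B C Q R S K) := by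
  have hRP : R.IsPositive := .of_adjoint_eq hR fun y => by
    rcases eq_or_ne y 0 with rfl | hy
    · simp
    · exact (hRpos y hy).le
  have hL : (S ∘ₗ LinearMap.adjoint C ∘ₗ Rinv) ∘ₗ R = S ∘ₗ LinearMap.adjoint C := by
    simp only [LinearMap.comp_assoc, hRinv₂, LinearMap.comp_id]
  have hsq := covRHS_sub_eq_of_comp_eq A B C Q hR hS hL K
  have hpos := hRP.conj_adjoint (K - S ∘ₗ LinearMap.adjoint C ∘ₗ Rinv)
  rw [← hsq] at hpos
  refine ⟨hsq, fun x => hpos.inner_nonneg_right x, ?_⟩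
  have htr := (LinearMap.IsPositive.of_adjoint_eq hM hMpos).trace_comp_nonneg hpos
  rwa [LinearMap.comp_sub, map_sub, sub_nonneg] at htr
end

section
/- Let H, Y, N be finite-dimensional real inner product spaces, A : H → H, B : N → H, C : H → Y, Q : N → N linear, R : Y → Y self-adjoint positive definite, Σ : H → H self-adjoint, and M : H → H self-adjoint positive definite. For K : Y → H linear, let F(K) := (A − K∘C)∘Σ + Σ∘(A − K∘C)* + B∘Q∘B* + K∘R∘K*, and K₀ := Σ∘C*∘R⁻¹. If trace(M ∘ F(K)) = trace(M ∘ F(K₀)), then K = K₀; i.e., the minimizing Kalman gain is unique. -/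
open scoped RealInnerProductSpace

section GainGap

variable {H Y N : Type*}
  [NormedAddCommGroup H] [InnerProductSpace ℝ H] [FiniteDimensional ℝ H]
  [NormedAddCommGroup Y] [InnerProductSpace ℝ Y] [FiniteDimensional ℝ Y]
  [NormedAddCommGroup N] [InnerProductSpace ℝ N] [FiniteDimensional ℝ N]

/-- Completing the square around a stationary gain `K₀`, one with `K₀ R = Σ C*`. -/
lemma covRHS_sub_covRHS (A : H →ₗ[ℝ] H) (B : N →ₗ[ℝ] H) (C : H →ₗ[ℝ] Y) (Q : N →ₗ[ℝ] N)
    {R : Y →ₗ[ℝ] Y} {S : H →ₗ[ℝ] H} (hR : LinearMap.adjoint R = R)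
    (hS : LinearMap.adjoint S = S) (K : Y →ₗ[ℝ] H) {K₀ : Y →ₗ[ℝ] H}
    (hK₀ : K₀ ∘ₗ R = S ∘ₗ LinearMap.adjoint C) :
    covRHS A B C Q R S K - covRHS A B C Q R S K₀
      = (K - K₀) ∘ₗ R ∘ₗ LinearMap.adjoint (K - K₀) := by
  have hK₀' : R ∘ₗ LinearMap.adjoint K₀ = C ∘ₗ S := by
    simpa [LinearMap.adjoint_comp, hR, hS] using congrArg LinearMap.adjoint hK₀
  have h (y : Y) : S (LinearMap.adjoint C y) = K₀ (R y) := (LinearMap.congr_fun hK₀ y).symm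
  have h' (x : H) : C (S x) = R (LinearMap.adjoint K₀ x) := (LinearMap.congr_fun hK₀' x).symm
  ext x
  simp only [covRHS, map_sub, LinearMap.adjoint_comp, LinearMap.sub_apply, LinearMap.add_apply,
    LinearMap.comp_apply, h, h']
  abel

/-- The trace of `M D R D*` is positive definite in `D` when `M` and `R` are positive definite. -/
lemma eq_zero_of_trace_comp_conj_eq_zero {R : Y →ₗ[ℝ] Y} {M : H →ₗ[ℝ] H} {D : Y →ₗ[ℝ] H}
    (hRpos : ∀ y : Y, y ≠ 0 → 0 < ⟪y, R y⟫) (hM : LinearMap.adjoint M = M)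
    (hMpos : ∀ x : H, x ≠ 0 → 0 < ⟪x, M x⟫)
    (htr : LinearMap.trace ℝ H (M ∘ₗ D ∘ₗ R ∘ₗ LinearMap.adjoint D) = 0) : D = 0 := by
  have hsymm : M.IsSymmetric := (LinearMap.isSymmetric_iff_isSelfAdjoint M).2 hM
  let b := hsymm.eigenvectorBasis rfl
  let μ := hsymm.eigenvalues rfl
  have hb (i) : M (b i) = μ i • b i := hsymm.apply_eigenvectorBasis rfl i
  have hμ (i) : 0 < μ i := by
    simpa [hb, inner_smul_right] using hMpos (b i) (b.orthonormal.ne_zero i)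
  have hRnonneg (y : Y) : 0 ≤ ⟪y, R y⟫ := by
    rcases eq_or_ne y 0 with rfl | hy
    · simp
    · exact (hRpos y hy).le
  have hterm (i) : ⟪b i, (M ∘ₗ D ∘ₗ R ∘ₗ LinearMap.adjoint D) (b i)⟫
      = μ i * ⟪LinearMap.adjoint D (b i), R (LinearMap.adjoint D (b i))⟫ := by
    simp only [LinearMap.comp_apply]
    rw [← hsymm, hb, real_inner_smul_left, LinearMap.adjoint_inner_left]
  rw [LinearMap.trace_eq_sum_inner _ b, Finset.sum_congr rfl fun i _ => hterm i,
    Finset.sum_eq_zero_iff_of_nonneg fun i _ => mul_nonneg (hμ i).le (hRnonneg _)] at htr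
  have hD : LinearMap.adjoint D = 0 := by
    refine b.toBasis.ext fun i => ?_
    by_contra hne
    simp only [OrthonormalBasis.coe_toBasis, LinearMap.zero_apply] at hne
    exact (mul_pos (hμ i) (hRpos _ hne)).ne' (htr i (Finset.mem_univ i))
  simpa using congrArg LinearMap.adjoint hD

end GainGap

/-- **uniqueness of the minimizing gain.**  With `R` self-adjoint positive
definite (with inverse `Rinv`), `Σ` self-adjoint, `M` self-adjoint positive definite, and
`K₀ := Σ C* R⁻¹`: if `trace (M ∘ F(K)) = trace (M ∘ F(K₀))` then `K = K₀`. -/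
theorem kalman_gain_unique
    {H Y N : Type*}
    [NormedAddCommGroup H] [InnerProductSpace ℝ H] [FiniteDimensional ℝ H]
    [NormedAddCommGroup Y] [InnerProductSpace ℝ Y] [FiniteDimensional ℝ Y]
    [NormedAddCommGroup N] [InnerProductSpace ℝ N] [FiniteDimensional ℝ N]
    (A : H →ₗ[ℝ] H) (B : N →ₗ[ℝ] H) (C : H →ₗ[ℝ] Y) (Q : N →ₗ[ℝ] N) (R Rinv : Y →ₗ[ℝ] Y)
    (S : H →ₗ[ℝ] H) (M : H →ₗ[ℝ] H)
    (hR : LinearMap.adjoint R = R)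
    (hRpos : ∀ y : Y, y ≠ 0 → 0 < ⟪y, R y⟫)
    (hRinv₁ : R ∘ₗ Rinv = LinearMap.id) (hRinv₂ : Rinv ∘ₗ R = LinearMap.id)
    (hS : LinearMap.adjoint S = S)
    (hM : LinearMap.adjoint M = M)
    (hMpos : ∀ x : H, x ≠ 0 → 0 < ⟪x, M x⟫)
    (K : Y →ₗ[ℝ] H)
    (htr : LinearMap.trace ℝ H (M ∘ₗ covRHS A B C Q R S K)
        = LinearMap.trace ℝ H (M ∘ₗ covRHS A B C Q R S (S ∘ₗ LinearMap.adjoint C ∘ₗ Rinv))) :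
    K = S ∘ₗ LinearMap.adjoint C ∘ₗ Rinv := by
  have hK₀ : (S ∘ₗ LinearMap.adjoint C ∘ₗ Rinv) ∘ₗ R = S ∘ₗ LinearMap.adjoint C := by
    rw [LinearMap.comp_assoc, LinearMap.comp_assoc, hRinv₂, LinearMap.comp_id]
  refine sub_eq_zero.1 (eq_zero_of_trace_comp_conj_eq_zero hRpos hM hMpos ?_)
  rw [← covRHS_sub_covRHS A B C Q hR hS K hK₀, LinearMap.comp_sub, map_sub, htr, sub_self]
end
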